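/- Let T > 0, σ_X > 0, σ_Y > 0, γ° > 0 and real constants p, q with 1 + p > 0, q < 2 and |p| + |q| ≠ 0. For C¹ functions ṽ6, ṽ8, β1, b2, β3, γ, χ on [0,T], write α := β3 + β1·χ and δ := p + q·α, and consider the boundary value problem: ṽ6' = γ·[−β1² + 2β1·b2 + b2² + ṽ6·(α²/σ_Y² + 2δ²χ/σ_X²)]; ṽ8' = γ·[(−2 + 4α)β1 − 2b2 + ṽ8·δ²χ/σ_X² − 4β1²χ]; β1' = (γ/(4σ_X²σ_Y²(1 + pχ)))·[2σ_X²α(δ² − αδ) + 4σ_X²αβ1(α − β1) + ṽ8·αχδ²(p − 2β1) + 4β1χ(p²σ_Y² + pα(pσ_X² + 2qσ_Y² − σ_X²β1)) + 4qβ1α²χ(2pσ_X² + qσ_Y² + σ_X²α(q − 1)) − 4σ_Y²δ²b2χ + 4σ_Y²δ²β1(p − 2b2)χ²]; b2' = (γ/(4σ_X²σ_Y²(1 + pχ)))·[2σ_X²α(p² + 2β1² + α(p(2q − 1) + 2b2)) + 2σ_X²α³q(q − 1) + αχδ²(−4ṽ6 + ṽ8(p − 2b2)) + 4αχσ_X²(pβ1²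 + (p² + qα(2p + (q − 1)α))·b2) − 4δ²(p·ṽ6·α + σ_Y²b2(−p + 2b2))χ²]; β3' = (γ/(4σ_X²σ_Y²(1 + pχ)))·[−4σ_X²α²β1 − χ²·ṽ8·αδ²(p − 2β1) + 2αχδ(−pσ_X² + σ_X²α(2p + (q − 1)(2α − 1))) − 2α²χ·ṽ8·δ² − 2αχ(2pσ_X²αβ1 − 2σ_X²β1²) − 4σ_X²χ²αβ1(pα(2q − 1) + qα²(q − 1) + p(p − β1)) − 4σ_Y²χ²δ²(−1 + 2α)b2 + 8σ_Y²δ²β1·b2·χ³]; γ' = −α²γ²/σ_Y²; χ' = γ·[α²(1 − χ)/σ_Y² − δ²χ²/σ_X²]; with boundary conditions γ(0) = γ°, χ(0) = 0, ṽ6(T) = ṽ8(T) = 0, β1(T) = b2(T) = (q + 2p)/(2(2 − q·χ(T))), β3(T) = 1/2. Then there exists a constant c > 0, depending only on (σ_X, σ_Y, p, q) and not on γ° or T, such that for every T with 0 < T < c/γ° this boundary value problem admits a C¹ solution, and this solution satisfies 0 < γ(t) ≤ γ°, 0 ≤ χ(t) < 1 and α(t) > 0 for all t ∈ [0,T]. 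-/

import Mathlib

open Set

section TwoPointBoundaryValue

variable {E : Type*} [NormedAddCommGroup E] [NormedSpace ℝ E] [CompleteSpace E]

/-- A two-point boundary value problem `u' = G u`, `u 0 = b (u S - u 0)` with globally Lipschitz
data has a solution when the horizon `S` is short, and this solution stays close to `b 0`. -/
theorem exists_solution_of_lipschitzWith {G b : E → E} {L K : NNReal}
    (hG : LipschitzWith L G) (hb : LipschitzWith K b) {S : ℝ} (hS : 0 ≤ S)
    (hsmall : (K + 1) * L * S ≤ 1 / 2) :
    ∃ u : ℝ → E, ContDiff ℝ 1 u ∧ u 0 = b (u S - u 0) ∧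
      ∀ t ∈ Icc 0 S, HasDerivAt u (G (u t)) t ∧
        ‖u t - b 0‖ ≤ 2 * ((K + 1) * ‖G (b 0)‖ * S) := by
  let ext (u : C(Icc 0 S, E)) : ℝ → E := IccExtend hS u
  have ext_cont (u : C(Icc 0 S, E)) : Continuous fun s => G (ext u s) :=
    hG.continuous.comp (u.continuous.Icc_extend' (h := hS))
  let I (u : C(Icc 0 S, E)) (t : ℝ) : E := ∫ s in (0 : ℝ)..t, G (ext u s)
  have I_deriv (u : C(Icc 0 S, E)) (t : ℝ) : HasDerivAt (I u) (G (ext u t)) t :=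
    (ext_cont u).integral_hasStrictDerivAt 0 t |>.hasDerivAt
  have I_cont (u : C(Icc 0 S, E)) : Continuous (I u) :=
    continuous_iff_continuousAt.2 fun t => (I_deriv u t).continuousAt
  let Φ (u : C(Icc 0 S, E)) : C(Icc 0 S, E) :=
    ⟨fun t => b (I u S) + I u t, by have := I_cont u; fun_prop⟩
  have I_sub (u v : C(Icc 0 S, E)) (t : ℝ) (ht : t ∈ Icc 0 S) :
      ‖I u t - I v t‖ ≤ L * dist u v * S := by
    have hint : I u t - I v t = ∫ s in (0 : ℝ)..t, (G (ext u s) - G (ext v s)) :=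
      (intervalIntegral.integral_sub ((ext_cont u).intervalIntegrable _ _)
        ((ext_cont v).intervalIntegrable _ _)).symm
    have hle : ‖I u t - I v t‖ ≤ L * dist u v * |t - 0| := by
      rw [hint]
      refine intervalIntegral.norm_integral_le_of_norm_le_const fun s _ => ?_
      rw [← dist_eq_norm]
      exact (hG.dist_le_mul _ _).trans
        (mul_le_mul_of_nonneg_left (ContinuousMap.dist_apply_le_dist _) L.2)
    rw [sub_zero, abs_of_nonneg ht.1] at hle
    exact hle.trans (mul_le_mul_of_nonneg_left ht.2 (by positivity))
  have hΦ : ContractingWith (1 / 2) Φ := by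
    refine ⟨by norm_num, LipschitzWith.of_dist_le_mul fun u v => ?_⟩
    refine (ContinuousMap.dist_le (by positivity)).2 fun t => ?_
    have h1 : dist (b (I u S)) (b (I v S)) ≤ K * (L * dist u v * S) :=
      (hb.dist_le_mul _ _).trans (mul_le_mul_of_nonneg_left
        (by rw [dist_eq_norm]; exact I_sub u v S (right_mem_Icc.2 hS)) K.2)
    have h2 : dist (I u t) (I v t) ≤ L * dist u v * S := by
      rw [dist_eq_norm]; exact I_sub u v t t.2
    calc dist (Φ u t) (Φ v t) ≤ dist (b (I u S)) (b (I v S)) + dist (I u t) (I v t) :=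
          dist_add_add_le _ _ _ _
      _ ≤ (K + 1) * L * S * dist u v := by linarith
      _ ≤ 1 / 2 * dist u v := mul_le_mul_of_nonneg_right hsmall dist_nonneg
      _ = ((1 / 2 : NNReal) : ℝ) * dist u v := by norm_num
  have : Nonempty C(Icc 0 S, E) := ⟨ContinuousMap.const _ 0⟩
  obtain ⟨w, hw⟩ : ∃ w, w = ContractingWith.fixedPoint Φ hΦ := ⟨_, rfl⟩
  have hfix : Φ w = w := by rw [hw]; exact hΦ.fixedPoint_isFixedPt
  have happly (t : Icc 0 S) : b (I w S) + I w t = w t := congrArg (fun f => f t) hfix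
  have hext (t : ℝ) (ht : t ∈ Icc 0 S) : ext w t = b (I w S) + I w t :=
    (IccExtend_of_mem hS w ht).trans (happly ⟨t, ht⟩).symm
  have I_zero (u : C(Icc 0 S, E)) : I u 0 = 0 := intervalIntegral.integral_same
  have hderiv (t : ℝ) : HasDerivAt (fun t => b (I w S) + I w t) (G (ext w t)) t :=
    (I_deriv w t).const_add _
  refine ⟨fun t => b (I w S) + I w t, ?_, ?_, fun t ht => ⟨?_, ?_⟩⟩
  · refine contDiff_one_iff_deriv.2 ⟨fun t => (hderiv t).differentiableAt, ?_⟩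
    rw [funext fun t => (hderiv t).deriv]
    exact ext_cont w
  · simp only [I_zero, add_zero, add_sub_cancel_left]
  · have h := hderiv t
    rwa [hext t ht] at h
  · let x : C(Icc 0 S, E) := ContinuousMap.const _ (b 0)
    have hI (t : ℝ) (ht : t ∈ Icc 0 S) : ‖I x t‖ ≤ ‖G (b 0)‖ * S := by
      have hle : ‖I x t‖ ≤ ‖G (b 0)‖ * |t - 0| :=
        intervalIntegral.norm_integral_le_of_norm_le_const fun s _ => le_rfl
      rw [sub_zero, abs_of_nonneg ht.1] at hle
      exact hle.trans (mul_le_mul_of_nonneg_left ht.2 (norm_nonneg _))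
    have hx : dist x (Φ x) ≤ (K + 1) * ‖G (b 0)‖ * S := by
      refine (ContinuousMap.dist_le (by positivity)).2 fun t => ?_
      have h1 : dist (b (I x S)) (b 0) ≤ K * (‖G (b 0)‖ * S) :=
        (hb.dist_le_mul _ _).trans (mul_le_mul_of_nonneg_left
          (by rw [dist_zero_right]; exact hI S (right_mem_Icc.2 hS)) K.2)
      have h2 : dist (I x t) 0 ≤ ‖G (b 0)‖ * S := by rw [dist_zero_right]; exact hI t t.2
      rw [dist_comm]
      calc dist (b (I x S) + I x t) (b 0) = dist (b (I x S) + I x t) (b 0 + 0) := by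
            rw [add_zero]
        _ ≤ dist (b (I x S)) (b 0) + dist (I x t) 0 := dist_add_add_le _ _ _ _
        _ ≤ (K + 1) * ‖G (b 0)‖ * S := by linarith
    have hdist : dist x w ≤ 2 * dist x (Φ x) := by
      have h := hΦ.dist_fixedPoint_le x
      rw [← hw] at h
      refine h.trans_eq ?_
      norm_num
      ring
    calc ‖b (I w S) + I w t - b 0‖ = dist (x ⟨t, ht⟩) (w ⟨t, ht⟩) := by
          rw [← happly ⟨t, ht⟩, dist_comm, dist_eq_norm]; rfl
      _ ≤ dist x w := ContinuousMap.dist_apply_le_dist _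
      _ ≤ 2 * ((K + 1) * ‖G (b 0)‖ * S) := by linarith

end TwoPointBoundaryValue

/-- Local version of `exists_solution_of_lipschitzWith`: the field and the boundary map only have
to be C¹ near the limiting data, and the solution stays in a prescribed neighbourhood. -/
theorem exists_solution_of_contDiffAt {ι : Type*} [Fintype ι] {G b : (ι → ℝ) → ι → ℝ}
    {x₀ : ι → ℝ} (hb0 : b 0 = x₀) (hG : ContDiffAt ℝ 1 G x₀) (hb : ContDiffAt ℝ 1 b 0)
    {U : Set (ι → ℝ)} (hU : U ∈ nhds x₀) :
    ∃ c : ℝ, 0 < c ∧ ∀ S, 0 < S → S < c →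
      ∃ u : ℝ → ι → ℝ, ContDiff ℝ 1 u ∧ u 0 = b (u S - u 0) ∧
        ∀ t ∈ Icc 0 S, HasDerivAt u (G (u t)) t ∧ u t ∈ U := by
  obtain ⟨L, V, hV, hGV⟩ := hG.exists_lipschitzOnWith
  obtain ⟨K, W, hW, hbW⟩ := hb.exists_lipschitzOnWith
  obtain ⟨G', hG', hGG'⟩ := hGV.extend_pi
  obtain ⟨b', hb', hbb'⟩ := hbW.extend_pi
  have hb'0 : b' 0 = x₀ := by rw [← hbb' (mem_of_mem_nhds hW), hb0]
  obtain ⟨r, hr, hrUV⟩ := Metric.mem_nhds_iff.1 (Filter.inter_mem hU hV)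
  obtain ⟨ρ, hρ, hρW⟩ := Metric.mem_nhds_iff.1 hW
  set M : ℝ := (K + 1) * L + (K + 1) * ‖G' x₀‖ + 1 with hM
  have hM0 : 0 < M := by positivity
  refine ⟨min (1 / 2) (min (r / 2) (ρ / 4)) / M, by positivity, fun S hS hSc => ?_⟩
  rw [lt_div_iff₀ hM0, lt_min_iff, lt_min_iff] at hSc
  have hsmall : (K + 1) * L * S ≤ S * M := by
    rw [hM]; nlinarith [show 0 ≤ (K + 1) * ‖G' x₀‖ * S by positivity]
  have hbound : (K + 1) * ‖G' x₀‖ * S ≤ S * M := by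
    rw [hM]; nlinarith [show 0 ≤ (K + 1) * L * S by positivity]
  obtain ⟨u, hu, hu0, hut⟩ :=
    exists_solution_of_lipschitzWith hG' hb' hS.le (hsmall.trans hSc.1.le)
  simp only [hb'0] at hut
  have hnear (t : ℝ) (ht : t ∈ Icc 0 S) : u t ∈ U ∩ V := by
    refine hrUV ?_
    rw [Metric.mem_ball, dist_eq_norm]
    linarith [(hut t ht).2]
  refine ⟨u, hu, ?_, fun t ht => ⟨?_, (hnear t ht).1⟩⟩
  · rw [hbb' (hρW _), ← hu0]
    have h0 := (hut 0 (left_mem_Icc.2 hS.le)).2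
    have h1 := (hut S (right_mem_Icc.2 hS.le)).2
    have := norm_sub_le (u S - x₀) (u 0 - x₀)
    rw [sub_sub_sub_cancel_right] at this
    rw [Metric.mem_ball, dist_zero_right]
    linarith
  · rw [hGG' (hnear t ht).2]
    exact (hut t ht).1

/-- The equilibrium vector field in the coordinates `(ṽ6, ṽ8, β1, b2, β3, γ, χ)`. -/
noncomputable def leadershipField (σX σY p q : ℝ) (x : Fin 7 → ℝ) : Fin 7 → ℝ :=
  let α := x 4 + x 2 * x 6
  let δ := p + q * α
  ![x 5 * (-x 2^2 + 2 * x 2 * x 3 + x 3^2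
      + x 0 * (α^2 / σY^2 + 2 * δ^2 * x 6 / σX^2)),
    x 5 * ((-2 + 4 * α) * x 2 - 2 * x 3
      + x 1 * δ^2 * x 6 / σX^2 - 4 * x 2^2 * x 6),
    (x 5 / (4 * σX^2 * σY^2 * (1 + p * x 6))) *
        (2 * σX^2 * α * (δ^2 - α * δ)
      + 4 * σX^2 * α * x 2 * (α - x 2)
      + x 1 * α * x 6 * δ^2 * (p - 2 * x 2)
      + 4 * x 2 * x 6 *
        (p^2 * σY^2 + p * α * (p * σX^2 + 2 * q * σY^2 - σX^2 * x 2))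
      + 4 * q * x 2 * α^2 * x 6 *
        (2 * p * σX^2 + q * σY^2 + σX^2 * α * (q - 1))
      - 4 * σY^2 * δ^2 * x 3 * x 6
      + 4 * σY^2 * δ^2 * x 2 * (p - 2 * x 3) * x 6^2),
    (x 5 / (4 * σX^2 * σY^2 * (1 + p * x 6))) *
        (2 * σX^2 * α * (p^2 + 2 * x 2^2 + α * (p * (2 * q - 1) + 2 * x 3))
      + 2 * σX^2 * α^3 * q * (q - 1)
      + α * x 6 * δ^2 * (-(4 * x 0) + x 1 * (p - 2 * x 3))
      + 4 * α * x 6 * σX^2 *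
        (p * x 2^2 + (p^2 + q * α * (2 * p + (q - 1) * α)) * x 3)
      - 4 * δ^2 * (p * x 0 * α + σY^2 * x 3 * (-p + 2 * x 3)) * x 6^2),
    (x 5 / (4 * σX^2 * σY^2 * (1 + p * x 6))) *
        (-(4 * σX^2 * α^2 * x 2)
      - x 6^2 * x 1 * α * δ^2 * (p - 2 * x 2)
      + 2 * α * x 6 * δ *
        (-(p * σX^2) + σX^2 * α * (2 * p + (q - 1) * (2 * α - 1)))
      - 2 * α^2 * x 6 * x 1 * δ^2
      - 2 * α * x 6 * (2 * p * σX^2 * α * x 2 - 2 * σX^2 * x 2^2)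
      - 4 * σX^2 * x 6^2 * α * x 2 *
        (p * α * (2 * q - 1) + q * α^2 * (q - 1) + p * (p - x 2))
      - 4 * σY^2 * x 6^2 * δ^2 * (-1 + 2 * α) * x 3
      + 8 * σY^2 * δ^2 * x 2 * x 3 * x 6^3),
    -α^2 * x 5^2 / σY^2,
    x 5 * (α^2 * (1 - x 6) / σY^2 - δ^2 * x 6^2 / σX^2)]

theorem contDiffAt_leadershipField (σX σY p q : ℝ) (hσX : 0 < σX) (hσY : 0 < σY)
    {x₀ : Fin 7 → ℝ} (hx₀ : 1 + p * x₀ 6 ≠ 0) :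
    ContDiffAt ℝ 1 (leadershipField σX σY p q) x₀ := by
  have hden : 4 * σX ^ 2 * σY ^ 2 * (1 + p * x₀ 6) ≠ 0 := by positivity
  refine contDiffAt_pi.2 fun i => ?_
  have hfac : ContDiffAt ℝ 1 (fun x : Fin 7 → ℝ =>
      x 5 / (4 * σX ^ 2 * σY ^ 2 * (1 + p * x 6))) x₀ :=
    ContDiffAt.div (by fun_prop) (by fun_prop) hden
  have hγ : ContDiffAt ℝ 1 (fun x : Fin 7 → ℝ => x 5) x₀ := by fun_prop
  fin_cases i
  · exact hγ.mul (by fun_prop)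
  · exact hγ.mul (by fun_prop)
  · exact hfac.mul (by fun_prop)
  · exact hfac.mul (by fun_prop)
  · exact hfac.mul (by fun_prop)
  · exact ContDiffAt.div_const (by fun_prop) _
  · exact hγ.mul (by fun_prop)

/-- The initial value as a function of the total increment `z` of a solution. -/
noncomputable def leadershipBoundary (p q : ℝ) (z : Fin 7 → ℝ) : Fin 7 → ℝ :=
  let h := (q + 2 * p) / (2 * (2 - q * z 6))
  ![-z 0, -z 1, h - z 2, h - z 3, 1 / 2 - z 4, 1, 0]

theorem contDiffAt_leadershipBoundary (p q : ℝ) : ContDiffAt ℝ 1 (leadershipBoundary p q) 0 := by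
  refine contDiffAt_pi.2 fun i => ?_
  have hfrac : ContDiffAt ℝ 1 (fun z : Fin 7 → ℝ => (q + 2 * p) / (2 * (2 - q * z 6))) 0 :=
    ContDiffAt.div (by fun_prop) (by fun_prop) (by simp)
  fin_cases i
  · exact (contDiff_apply ℝ ℝ 0).contDiffAt.neg
  · exact (contDiff_apply ℝ ℝ 1).contDiffAt.neg
  · exact hfrac.sub (by fun_prop)
  · exact hfrac.sub (by fun_prop)
  · exact contDiffAt_const.sub (contDiff_apply ℝ ℝ 4).contDiffAt
  · exact contDiffAt_const
  · exact contDiffAt_const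

/-- Existence of a linear Markov equilibrium in the common-value leadership
model (Cisternas–Kolb, Theorem 2): for every horizon `T < c/γ°`, the boundary
value problem for `(ṽ6, ṽ8, β1, b2, β3, γ, χ)` — with `α = β3 + β1·χ`,
`δ = p + q·α` — admits a C¹ solution satisfying `0 < γ ≤ γ°`, `0 ≤ χ < 1` and
`α > 0`, where `c > 0` depends only on `(σX, σY, p, q)`. -/
theorem stmt_0 (σX σY p q : ℝ) (hσX : 0 < σX) (hσY : 0 < σY)
    (hp : 0 < 1 + p) (hq : q < 2) (hpq : |p| + |q| ≠ 0) :
    ∃ c : ℝ, 0 < c ∧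
      ∀ γo T : ℝ, 0 < γo → 0 < T → T < c / γo →
        ∃ v6 v8 β1 b2 β3 γ χ α δ : ℝ → ℝ,
          (∀ t, α t = β3 t + β1 t * χ t) ∧
          (∀ t, δ t = p + q * α t) ∧
          ContDiffOn ℝ 1 v6 (Icc 0 T) ∧ ContDiffOn ℝ 1 v8 (Icc 0 T) ∧
          ContDiffOn ℝ 1 β1 (Icc 0 T) ∧ ContDiffOn ℝ 1 b2 (Icc 0 T) ∧
          ContDiffOn ℝ 1 β3 (Icc 0 T) ∧ ContDiffOn ℝ 1 γ (Icc 0 T) ∧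
          ContDiffOn ℝ 1 χ (Icc 0 T) ∧
          (∀ t ∈ Icc (0:ℝ) T, HasDerivWithinAt v6
            (γ t * (-(β1 t)^2 + 2 * β1 t * b2 t + (b2 t)^2
              + v6 t * ((α t)^2 / σY^2 + 2 * (δ t)^2 * χ t / σX^2)))
            (Icc 0 T) t) ∧
          (∀ t ∈ Icc (0:ℝ) T, HasDerivWithinAt v8
            (γ t * ((-2 + 4 * α t) * β1 t - 2 * b2 t
              + v8 t * (δ t)^2 * χ t / σX^2 - 4 * (β1 t)^2 * χ t))
            (Icc 0 T) t) ∧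
          (∀ t ∈ Icc (0:ℝ) T, HasDerivWithinAt β1
            ((γ t / (4 * σX^2 * σY^2 * (1 + p * χ t))) *
              (2 * σX^2 * α t * ((δ t)^2 - α t * δ t)
                + 4 * σX^2 * α t * β1 t * (α t - β1 t)
                + v8 t * α t * χ t * (δ t)^2 * (p - 2 * β1 t)
                + 4 * β1 t * χ t *
                    (p^2 * σY^2 + p * α t * (p * σX^2 + 2 * q * σY^2 - σX^2 * β1 t))
                + 4 * q * β1 t * (α t)^2 * χ t *
                    (2 * p * σX^2 + q * σY^2 + σX^2 * α t * (q - 1))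
                - 4 * σY^2 * (δ t)^2 * b2 t * χ t
                + 4 * σY^2 * (δ t)^2 * β1 t * (p - 2 * b2 t) * (χ t)^2))
            (Icc 0 T) t) ∧
          (∀ t ∈ Icc (0:ℝ) T, HasDerivWithinAt b2
            ((γ t / (4 * σX^2 * σY^2 * (1 + p * χ t))) *
              (2 * σX^2 * α t * (p^2 + 2 * (β1 t)^2 + α t * (p * (2 * q - 1) + 2 * b2 t))
                + 2 * σX^2 * (α t)^3 * q * (q - 1)
                + α t * χ t * (δ t)^2 * (-(4 * v6 t) + v8 t * (p - 2 * b2 t))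
                + 4 * α t * χ t * σX^2 *
                    (p * (β1 t)^2 + (p^2 + q * α t * (2 * p + (q - 1) * α t)) * b2 t)
                - 4 * (δ t)^2 * (p * v6 t * α t + σY^2 * b2 t * (-p + 2 * b2 t)) * (χ t)^2))
            (Icc 0 T) t) ∧
          (∀ t ∈ Icc (0:ℝ) T, HasDerivWithinAt β3
            ((γ t / (4 * σX^2 * σY^2 * (1 + p * χ t))) *
              (-(4 * σX^2 * (α t)^2 * β1 t)
                - (χ t)^2 * v8 t * α t * (δ t)^2 * (p - 2 * β1 t)
                + 2 * α t * χ t * δ t *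
                    (-(p * σX^2) + σX^2 * α t * (2 * p + (q - 1) * (2 * α t - 1)))
                - 2 * (α t)^2 * χ t * v8 t * (δ t)^2
                - 2 * α t * χ t * (2 * p * σX^2 * α t * β1 t - 2 * σX^2 * (β1 t)^2)
                - 4 * σX^2 * (χ t)^2 * α t * β1 t *
                    (p * α t * (2 * q - 1) + q * (α t)^2 * (q - 1) + p * (p - β1 t))
                - 4 * σY^2 * (χ t)^2 * (δ t)^2 * (-1 + 2 * α t) * b2 t
                + 8 * σY^2 * (δ t)^2 * β1 t * b2 t * (χ t)^3))
            (Icc 0 T) t) ∧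
          (∀ t ∈ Icc (0:ℝ) T, HasDerivWithinAt γ
            (-(α t)^2 * (γ t)^2 / σY^2) (Icc 0 T) t) ∧
          (∀ t ∈ Icc (0:ℝ) T, HasDerivWithinAt χ
            (γ t * ((α t)^2 * (1 - χ t) / σY^2 - (δ t)^2 * (χ t)^2 / σX^2))
            (Icc 0 T) t) ∧
          γ 0 = γo ∧ χ 0 = 0 ∧ v6 T = 0 ∧ v8 T = 0 ∧
          β1 T = (q + 2 * p) / (2 * (2 - q * χ T)) ∧
          b2 T = (q + 2 * p) / (2 * (2 - q * χ T)) ∧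
          β3 T = 1/2 ∧
          (∀ t ∈ Icc (0:ℝ) T,
            0 < γ t ∧ γ t ≤ γo ∧ 0 ≤ χ t ∧ χ t < 1 ∧ 0 < α t) := by
  obtain ⟨x₀, hx₀⟩ : ∃ x₀, leadershipBoundary p q 0 = x₀ := ⟨_, rfl⟩
  have h4 : x₀ 4 = 1 / 2 := hx₀ ▸ sub_zero _
  have h5 : x₀ 5 = 1 := hx₀ ▸ rfl
  have h6 : x₀ 6 = 0 := hx₀ ▸ rfl
  have hG : ContDiffAt ℝ 1 (leadershipField σX σY p q) x₀ :=
    contDiffAt_leadershipField σX σY p q hσX hσY (by simp [h6])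
  have hU : {x : Fin 7 → ℝ | 0 < x 5 ∧ x 6 < 1 ∧ 0 < x 4 + x 2 * x 6 ∧
      0 < leadershipField σX σY p q x 6} ∈ nhds x₀ := by
    have hγ : ∀ᶠ x in nhds x₀, 0 < x 5 :=
      continuousAt_const.eventually_lt (continuous_apply 5).continuousAt (by simp [h5])
    have hχ : ∀ᶠ x in nhds x₀, x 6 < 1 :=
      (continuous_apply 6).continuousAt.eventually_lt continuousAt_const (by simp [h6])
    have hα : ∀ᶠ x in nhds x₀, 0 < x 4 + x 2 * x 6 :=
      ContinuousAt.eventually_lt (f := fun _ => 0) (g := fun x : Fin 7 → ℝ => x 4 + x 2 * x 6)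
        continuousAt_const (by fun_prop) (by simp [h4, h6])
    refine hγ.and (hχ.and (hα.and ?_))
    refine continuousAt_const.eventually_lt
      ((continuous_apply 6).continuousAt.comp hG.continuousAt) ?_
    have : leadershipField σX σY p q x₀ 6 = (1 / 2) ^ 2 / σY ^ 2 := by
      simp [leadershipField, h4, h5, h6]
    rw [this]
    positivity
  obtain ⟨c, hc, hsol⟩ :=
    exists_solution_of_contDiffAt hx₀ hG (contDiffAt_leadershipBoundary p q) hU
  refine ⟨c, hc, fun γo T hγo hT hTc => ?_⟩
  obtain ⟨u, hu, hu0, hut⟩ := hsol (γo * T) (by positivity)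
    (by rwa [mul_comm, ← lt_div_iff₀ hγo])
  have hmem (t : ℝ) (ht : t ∈ Icc 0 T) : γo * t ∈ Icc 0 (γo * T) :=
    ⟨mul_nonneg hγo.le ht.1, mul_le_mul_of_nonneg_left ht.2 hγo.le⟩
  have hcont (i : Fin 7) : ContDiff ℝ 1 fun t => u (γo * t) i :=
    (contDiff_pi.1 hu i).comp (contDiff_const.mul contDiff_id)
  have hderiv (t : ℝ) (ht : t ∈ Icc 0 T) (i : Fin 7) :
      HasDerivWithinAt (fun t => u (γo * t) i)
        (γo * leadershipField σX σY p q (u (γo * t)) i) (Icc 0 T) t := by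
    have h := (hasDerivAt_pi.1 (hut _ (hmem t ht)).1 i).comp t
      ((hasDerivAt_id t).const_mul γo)
    rw [mul_one, mul_comm] at h
    exact h.hasDerivWithinAt
  have hbd (i : Fin 7) := congrFun hu0 i
  have b0 := hbd 0
  have b1 := hbd 1
  have b2 := hbd 2
  have b3 := hbd 3
  have b4 := hbd 4
  have hγ0 : u 0 5 = 1 := hbd 5
  have hχ0 : u 0 6 = 0 := hbd 6
  simp only [leadershipBoundary, hχ0, Matrix.cons_val, Pi.sub_apply, sub_zero] at b0 b1 b2 b3 b4
  have hγ_anti : AntitoneOn (fun t => u t 5) (Icc 0 (γo * T)) := by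
    refine antitoneOn_of_deriv_nonpos (convex_Icc _ _)
      (contDiff_pi.1 hu 5).continuous.continuousOn
      ((contDiff_pi.1 hu 5).differentiable one_ne_zero).differentiableOn fun t ht => ?_
    rw [(hasDerivAt_pi.1 (hut t (interior_subset ht)).1 5).deriv]
    have : leadershipField σX σY p q (u t) 5 =
        -((u t 4 + u t 2 * u t 6) ^ 2 * (u t 5) ^ 2 / σY ^ 2) := by
      simp [leadershipField]; ring
    rw [this, neg_nonpos]
    positivity
  have hχ_mono : MonotoneOn (fun t => u t 6) (Icc 0 (γo * T)) := by
    refine monotoneOn_of_deriv_nonneg (convex_Icc _ _)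
      (contDiff_pi.1 hu 6).continuous.continuousOn
      ((contDiff_pi.1 hu 6).differentiable one_ne_zero).differentiableOn fun t ht => ?_
    have h := hut t (interior_subset ht)
    rw [(hasDerivAt_pi.1 h.1 6).deriv]
    exact h.2.2.2.2.le
  have h0mem : (0 : ℝ) ∈ Icc 0 (γo * T) := left_mem_Icc.2 (by positivity)
  refine ⟨fun t => u (γo * t) 0, fun t => u (γo * t) 1, fun t => u (γo * t) 2,
    fun t => u (γo * t) 3, fun t => u (γo * t) 4, fun t => γo * u (γo * t) 5,
    fun t => u (γo * t) 6, fun t => u (γo * t) 4 + u (γo * t) 2 * u (γo * t) 6,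
    fun t => p + q * (u (γo * t) 4 + u (γo * t) 2 * u (γo * t) 6),
    fun _ => rfl, fun _ => rfl, (hcont 0).contDiffOn, (hcont 1).contDiffOn,
    (hcont 2).contDiffOn, (hcont 3).contDiffOn, (hcont 4).contDiffOn,
    (contDiff_const.mul (hcont 5)).contDiffOn, (hcont 6).contDiffOn,
    fun t ht => ?_, fun t ht => ?_, fun t ht => ?_, fun t ht => ?_, fun t ht => ?_,
    fun t ht => ?_, fun t ht => ?_, ?_, ?_, ?_, ?_, ?_, ?_, ?_, fun t ht => ?_⟩
  · exact (hderiv t ht 0).congr_deriv (mul_assoc _ _ _).symm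
  · exact (hderiv t ht 1).congr_deriv (mul_assoc _ _ _).symm
  · rw [mul_div_assoc, mul_assoc]
    exact hderiv t ht 2
  · rw [mul_div_assoc, mul_assoc]
    exact hderiv t ht 3
  · rw [mul_div_assoc, mul_assoc]
    exact hderiv t ht 4
  · refine ((hderiv t ht 5).const_mul γo).congr_deriv ?_
    simp [leadershipField]
    ring
  · exact (hderiv t ht 6).congr_deriv (mul_assoc _ _ _).symm
  · simp [hγ0]
  · simp [hχ0]
  · linarith
  · linarith
  · linarith
  · linarith
  · linarith
  · obtain ⟨hγ, hχ, hα, -⟩ := (hut _ (hmem t ht)).2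
    have hγle := hγ_anti h0mem (hmem t ht) (hmem t ht).1
    have hχle := hχ_mono h0mem (hmem t ht) (hmem t ht).1
    simp only [hγ0, hχ0] at hγle hχle
    exact ⟨mul_pos hγo hγ, mul_le_of_le_one_right hγo.le hγle, hχle, hχ, hα⟩
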